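/- (Lemma A.1, quantum-plane form.) Let e be a positive integer and β, β' integers. In the completed quantum plane A_{2e} (so Y₂Y₁ = v^{4e}·Y₁Y₂), both of the following identities hold: (i) Ψ_{v^e}(v^{β'}·Y₂) · Ψ_{v^{2e}}(v^{β}·Y₁) = Ψ_{v^{2e}}(v^{β}·Y₁) · Ψ_{v^e}(v^{β+β'}·y^{(1,1)}) · Ψ_{v^{2e}}(v^{β+2β'}·y^{(1,2)}) · Ψ_{v^e}(v^{β'}·Y₂); and (ii) Ψ_{v^{2e}}(v^{β'}·Y₂) · Ψ_{v^{e}}(v^{β}·Y₁) = Ψ_{v^{e}}(v^{β}·Y₁) · Ψ_{v^{2e}}(v^{2β+β'}·y^{(2,1)}) · Ψ_{v^{e}}(v^{β+β'}·y^{(1,1)}) · Ψ_{v^{2e}}(v^{β'}·Y₂). (These are the relations [n']_{c/2,b'}[n]_{c,b} = [n]_{c,b}[n+n']_{c/2,b+b'}[n+2n']_{c,b+2b'}[n']_{c/2,b'} and [n']_{c,b'}[n]_{c/2,b} = [n]_{c/2,b}[2n+n']_{c,2b+b'}[n+n']_{c/2,b+b'}[n']_{c,b'} for {n',n} = c > 0,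 rendered with q^c = v^{2e}.) -/

import Mathlib

noncomputable section

open Filter

abbrev K : Type := RatFunc ℚ

/-- The indeterminate generator `v` of `K = ℚ(v)`. -/
def v : K := RatFunc.X

/-- The completed quantum plane: formal series `Σ c_{m,n}·Y₁^m Y₂^n`, encoded as
coefficient functions `ℕ × ℕ → K`. -/
abbrev QP : Type := (ℕ × ℕ) → K

/-- The twisted product of the completed quantum plane `A_γ`:
`(Y₁^a Y₂^b)·(Y₁^{a'} Y₂^{b'}) = v^{2γba'}·Y₁^{a+a'} Y₂^{b+b'}`, extended bilinearly and
continuously for the coefficientwise topology. -/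
def qmul (γ : ℕ) (F G : QP) : QP := fun p =>
  ∑ a ∈ Finset.range (p.1 + 1), ∑ b ∈ Finset.range (p.2 + 1),
    v ^ (2 * γ * b * (p.1 - a)) * F (a, b) * G (p.1 - a, p.2 - b)

/-- The multiplicative unit of the completed quantum plane. -/
def qone : QP := fun p => if p = (0, 0) then 1 else 0

/-- Powers in the completed quantum plane. -/
def qpow (γ : ℕ) (Z : QP) : ℕ → QP
  | 0 => qone
  | k + 1 => qmul γ Z (qpow γ Z k)

/-- The element `v^β · y^{(m,n)} = v^{β + γmn} · Y₁^m Y₂^n` of `A_γ`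
(`y^{(m,n)} := v^{γmn}·Y₁^m Y₂^n` is the normalized quantum monomial). -/
def qy (γ : ℕ) (β : ℤ) (m n : ℕ) : QP := fun p =>
  if p = (m, n) then v ^ (β + (γ : ℤ) * (m : ℤ) * (n : ℤ)) else 0

/-- The series `Σ_{j≥1} ((−1)^{j+1}/(j·(w^j − w^{−j})))·Z^j` (for `Z` with zero
constant term, the coefficient at `(m,n)` only involves `j ≤ m + n`). -/
def qarg (γ : ℕ) (w : K) (Z : QP) : QP := fun r =>
  ∑ j ∈ Finset.Icc 1 (r.1 + r.2),
    ((-1 : K) ^ (j + 1) / ((j : K) * (w ^ j - w⁻¹ ^ j))) * qpow γ Z j r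

/-- The quantum dilogarithm `Ψ_w(Z) = exp(Σ_{j≥1} ((−1)^{j+1}/(j(w^j − w^{−j})))·Z^j)`
in `A_γ`, for `Z` with zero constant term. -/
def qPsi (γ : ℕ) (w : K) (Z : QP) : QP := fun p =>
  ∑ k ∈ Finset.range (p.1 + p.2 + 1),
    ((Nat.factorial k : K)⁻¹) * qpow γ (qarg γ w Z) k p

/-- The ordered product `→∏_{p=a..b} g_p = g_a g_{a+1} ⋯ g_b` in `A_γ`. -/
def qprodR (γ : ℕ) (g : ℕ → QP) (a b : ℕ) : QP :=
  ((List.range' a (b + 1 - a)).map g).foldr (qmul γ) qone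

/-- The ordered product `←∏_{p=a..b} g_p = g_b ⋯ g_{a+1} g_a` in `A_γ`. -/
def qprodL (γ : ℕ) (g : ℕ → QP) (a b : ℕ) : QP :=
  ((List.range' a (b + 1 - a)).reverse.map g).foldr (qmul γ) qone


/-- The completed quantum plane `A_γ`, carrying the ring structure given by `qmul γ`. -/
def QPlane (_γ : ℕ) : Type := QP

namespace QPlane

variable {γ : ℕ}

instance : AddCommGroup (QPlane γ) := inferInstanceAs (AddCommGroup ((ℕ × ℕ) → K))

instance : Module K (QPlane γ) := inferInstanceAs (Module K ((ℕ × ℕ) → K))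

instance : Mul (QPlane γ) := ⟨qmul γ⟩

instance : One (QPlane γ) := ⟨qone⟩

/-- The coefficient of `Y₁^m Y₂^n`. -/
def coeff (F : QPlane γ) (m n : ℕ) : K := F (m, n)

@[ext]
theorem ext {F G : QPlane γ} (h : ∀ m n, F.coeff m n = G.coeff m n) : F = G :=
  funext fun p => h p.1 p.2

@[simp]
theorem coeff_zero (m n : ℕ) : (0 : QPlane γ).coeff m n = 0 := rfl

@[simp]
theorem coeff_add (F G : QPlane γ) (m n : ℕ) :
    (F + G).coeff m n = F.coeff m n + G.coeff m n := rfl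

@[simp]
theorem coeff_sub (F G : QPlane γ) (m n : ℕ) :
    (F - G).coeff m n = F.coeff m n - G.coeff m n := rfl

@[simp]
theorem coeff_smul (c : K) (F : QPlane γ) (m n : ℕ) :
    (c • F).coeff m n = c * F.coeff m n := rfl

theorem coeff_one (m n : ℕ) : (1 : QPlane γ).coeff m n = if m = 0 ∧ n = 0 then 1 else 0 := by
  change qone (m, n) = _
  simp [qone]

open Finset in
theorem coeff_mul (F G : QPlane γ) (m n : ℕ) :
    (F * G).coeff m n = ∑ x ∈ antidiagonal m, ∑ y ∈ antidiagonal n,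
      v ^ (2 * γ * y.1 * x.2) * F.coeff x.1 y.1 * G.coeff x.2 y.2 := by
  rw [Nat.sum_antidiagonal_eq_sum_range_succ_mk]
  change qmul γ F G (m, n) = _
  refine sum_congr rfl fun a _ => ?_
  rw [Nat.sum_antidiagonal_eq_sum_range_succ_mk]
  rfl

open Finset in
theorem sum_antidiagonal_assoc (n : ℕ) (f : ℕ → ℕ → ℕ → K) :
    ∑ x ∈ antidiagonal n, ∑ u ∈ antidiagonal x.1, f u.1 u.2 x.2 =
      ∑ x ∈ antidiagonal n, ∑ u ∈ antidiagonal x.2, f x.1 u.1 u.2 := by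
  rw [sum_sigma', sum_sigma']
  refine sum_nbij' (fun p => ⟨(p.2.1, p.2.2 + p.1.2), (p.2.2, p.1.2)⟩)
    (fun p => ⟨(p.1.1 + p.2.1, p.2.2), (p.1.1, p.2.1)⟩) ?_ ?_ ?_ ?_ ?_
  all_goals
    rintro ⟨⟨a, b⟩, ⟨c, d⟩⟩ h
    simp only [mem_sigma, HasAntidiagonal.mem_antidiagonal] at h
    obtain ⟨rfl, rfl⟩ := h
    simp [add_assoc]

open Finset in
protected theorem mul_assoc (F G H : QPlane γ) : F * G * H = F * (G * H) := by
  ext m n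
  set f : ℕ → ℕ → ℕ → ℕ → ℕ → ℕ → K := fun a₁ a₂ a₃ b₁ b₂ b₃ =>
    v ^ (2 * γ * (b₁ * a₂ + b₁ * a₃ + b₂ * a₃)) *
      (F.coeff a₁ b₁ * G.coeff a₂ b₂ * H.coeff a₃ b₃) with hf
  trans ∑ x ∈ antidiagonal m, ∑ u ∈ antidiagonal x.1, ∑ y ∈ antidiagonal n,
    ∑ z ∈ antidiagonal y.1, f u.1 u.2 x.2 z.1 z.2 y.2
  · rw [coeff_mul]
    refine sum_congr rfl fun x _ => ?_
    rw [sum_comm]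
    refine sum_congr rfl fun y _ => ?_
    rw [coeff_mul, mul_sum, sum_mul]
    refine sum_congr rfl fun u _ => ?_
    rw [mul_sum, sum_mul]
    refine sum_congr rfl fun z hz => ?_
    rw [hf, ← HasAntidiagonal.mem_antidiagonal.1 hz]
    ring
  · rw [sum_antidiagonal_assoc m fun a₁ a₂ a₃ => ∑ y ∈ antidiagonal n,
      ∑ z ∈ antidiagonal y.1, f a₁ a₂ a₃ z.1 z.2 y.2, coeff_mul]
    refine sum_congr rfl fun x _ => ?_
    simp_rw [fun u : ℕ × ℕ => sum_antidiagonal_assoc n (f x.1 u.1 u.2)]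
    rw [sum_comm]
    refine sum_congr rfl fun y _ => ?_
    rw [coeff_mul, mul_sum]
    refine sum_congr rfl fun u hu => ?_
    rw [mul_sum]
    refine sum_congr rfl fun z _ => ?_
    rw [hf, ← HasAntidiagonal.mem_antidiagonal.1 hu]
    ring

open Finset in
protected theorem one_mul (F : QPlane γ) : 1 * F = F := by
  ext m n
  rw [coeff_mul, sum_eq_single (0, m), sum_eq_single (0, n)]
  · simp [coeff_one]
  · rintro ⟨a, b⟩ h h'
    simp only [HasAntidiagonal.mem_antidiagonal] at h
    have : a ≠ 0 := by rintro rfl; simp_all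
    simp [coeff_one, this]
  · simp
  · rintro ⟨a, b⟩ h h'
    simp only [HasAntidiagonal.mem_antidiagonal] at h
    have : a ≠ 0 := by rintro rfl; simp_all
    simp [coeff_one, this]
  · simp

open Finset in
protected theorem mul_one (F : QPlane γ) : F * 1 = F := by
  ext m n
  rw [coeff_mul, sum_eq_single (m, 0), sum_eq_single (n, 0)]
  · simp [coeff_one]
  · rintro ⟨a, b⟩ h h'
    simp only [HasAntidiagonal.mem_antidiagonal] at h
    have : b ≠ 0 := by rintro rfl; simp_all
    simp [coeff_one, this]
  · simp
  · rintro ⟨a, b⟩ h h'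
    simp only [HasAntidiagonal.mem_antidiagonal] at h
    have : b ≠ 0 := by rintro rfl; simp_all
    simp [coeff_one, this]
  · simp

instance : Ring (QPlane γ) where
  mul_assoc := QPlane.mul_assoc
  one_mul := QPlane.one_mul
  mul_one := QPlane.mul_one
  left_distrib F G H := by
    ext m n
    simp only [coeff_mul, coeff_add, mul_add, Finset.sum_add_distrib]
  right_distrib F G H := by
    ext m n
    simp only [coeff_mul, coeff_add, mul_add, add_mul, Finset.sum_add_distrib]
  zero_mul F := by
    ext m n
    simp [coeff_mul]
  mul_zero F := by
    ext m n
    simp [coeff_mul]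
  __ := (inferInstance : AddCommGroup (QPlane γ))

instance : Algebra K (QPlane γ) :=
  Algebra.ofModule
    (fun c F G => by
      ext m n
      simp only [coeff_mul, coeff_smul, Finset.mul_sum]
      refine Finset.sum_congr rfl fun _ _ => Finset.sum_congr rfl fun _ _ => ?_
      ring)
    (fun c F G => by
      ext m n
      simp only [coeff_mul, coeff_smul, Finset.mul_sum]
      refine Finset.sum_congr rfl fun _ _ => Finset.sum_congr rfl fun _ _ => ?_
      ring)

theorem qpow_eq_pow (Z : QPlane γ) (k : ℕ) : qpow γ Z k = Z ^ k := by
  induction k with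
  | zero => rfl
  | succ k ih =>
    rw [pow_succ', ← ih]
    rfl

end QPlane

open PowerSeries in
/-- The quantum dilogarithm `Ψ_w` as a power series in one commuting variable. -/
def dilog (w : K) : PowerSeries K :=
  mk fun n => ∏ i ∈ Finset.range n, w / (w ^ (2 * (i + 1)) - 1)

open PowerSeries in
/-- The logarithm of the quantum dilogarithm, as a power series in one commuting variable. -/
def logDilog (w : K) : PowerSeries K :=
  mk fun j => (-1) ^ (j + 1) / ((j : K) * (w ^ j - w⁻¹ ^ j))

namespace PowerSeries

theorem constantCoeff_dilog (w : K) : constantCoeff (dilog w) = 1 := by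
  simp [dilog, ← coeff_zero_eq_constantCoeff_apply]

theorem constantCoeff_logDilog (w : K) : constantCoeff (logDilog w) = 0 := by
  simp [logDilog, ← coeff_zero_eq_constantCoeff_apply]

theorem coeff_one_add_smul_X_mul_zero (w : K) (f : PowerSeries K) :
    coeff 0 ((1 + w • X) * f) = coeff 0 f := by
  simp [add_mul]

theorem coeff_one_add_smul_X_mul_succ (w : K) (f : PowerSeries K) (n : ℕ) :
    coeff (n + 1) ((1 + w • X) * f) = coeff (n + 1) f + w * coeff n f := by
  simp [add_mul, coeff_succ_X_mul]

theorem rescale_sq_dilog {w : K} (hw : ∀ j, w ^ (2 * (j + 1)) ≠ 1) :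
    rescale (w ^ 2) (dilog w) = (1 + w • X) * dilog w := by
  ext n
  cases n with
  | zero => rw [coeff_one_add_smul_X_mul_zero]; simp
  | succ n =>
    rw [coeff_one_add_smul_X_mul_succ, coeff_rescale, dilog, coeff_mk, coeff_mk,
      Finset.prod_range_succ]
    have := sub_ne_zero.2 (hw n)
    field_simp
    ring

theorem eq_zero_of_rescale_sq {w : K} (hw : ∀ j, w ^ (2 * (j + 1)) ≠ 1) {R : PowerSeries K}
    (hR : rescale (w ^ 2) R = (1 + w • X) * R) (h0 : coeff 0 R = 0) : R = 0 := by
  ext n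
  induction n with
  | zero => simpa using h0
  | succ n ih =>
    have h := congrArg (coeff (n + 1)) hR
    rw [coeff_one_add_smul_X_mul_succ, coeff_rescale, ih, map_zero, mul_zero, add_zero,
      ← pow_mul] at h
    have h2 : (w ^ (2 * (n + 1)) - 1) * coeff (n + 1) R = 0 := by linear_combination h
    simpa [sub_ne_zero.2 (hw n)] using h2

theorem coeff_X_mul_derivative (f : PowerSeries K) (n : ℕ) :
    coeff n (X * derivative K f) = n * coeff n f := by
  cases n with
  | zero => simp
  | succ n => simp [coeff_succ_X_mul, coeff_derivative, mul_comm]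

theorem derivative_dilog {w : K} (hw0 : w ≠ 0) (hw : ∀ j, w ^ (2 * (j + 1)) ≠ 1) :
    derivative K (dilog w) = derivative K (logDilog w) * dilog w := by
  set g := dilog w
  set H := X * derivative K (logDilog w) with hH
  have hS : (1 + w • X) * (rescale (w ^ 2) H - H) = w • X := by
    have hSn : ∀ n, coeff (n + 1) (rescale (w ^ 2) H - H) = (-1) ^ n * w ^ (n + 1) := by
      intro n
      rw [map_sub, coeff_rescale, hH, coeff_X_mul_derivative, logDilog, coeff_mk]
      have h1 := sub_ne_zero.2 (hw n)
      have h2 : w ^ (n + 1) - w⁻¹ ^ (n + 1) = (w ^ (2 * (n + 1)) - 1) / w ^ (n + 1) := by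
        rw [inv_pow]
        field_simp
        ring
      have h3 : ((n + 1 : ℕ) : K) ≠ 0 := Nat.cast_ne_zero.2 n.succ_ne_zero
      rw [h2, ← pow_mul]
      generalize ((n + 1 : ℕ) : K) = N at h3
      field_simp
      ring
    have hS0 : coeff 0 (rescale (w ^ 2) H - H) = 0 := by simp [hH]
    ext n
    rcases n with _ | _ | n
    · rw [coeff_one_add_smul_X_mul_zero, hS0]
      simp
    · rw [coeff_one_add_smul_X_mul_succ, hS0, hSn]
      simp
    · rw [coeff_one_add_smul_X_mul_succ, hSn, hSn]
      simp [coeff_X]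
      ring
  have hg : rescale (w ^ 2) (X * derivative K g) = X * derivative K ((1 + w • X) * g) := by
    rw [← rescale_sq_dilog hw]
    ext n
    rw [coeff_rescale, coeff_X_mul_derivative, coeff_X_mul_derivative, coeff_rescale]
    ring
  have hR : X * derivative K g - H * g = 0 := by
    refine eq_zero_of_rescale_sq hw ?_ (by simp [hH])
    have hd : derivative K ((1 + w • X) * g) = (1 + w • X) * derivative K g + g * w • 1 := by
      rw [Derivation.leibniz, map_add, derivative_one, Derivation.map_smul, derivative_X]
      simp
    have hl : (w • (1 : PowerSeries K)) * X = w • X := by simp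
    rw [map_sub, map_mul _ H, hg, hd, rescale_sq_dilog hw]
    linear_combination (-g) * hS + g * hl
  have hX : X * (derivative K g - derivative K (logDilog w) * g) = 0 := by
    rw [← hR, hH]
    ring
  exact sub_eq_zero.1 ((mul_eq_zero.1 hX).resolve_left X_ne_zero)

theorem coeff_pow_eq_zero {L : PowerSeries K} (hL : constantCoeff L = 0) {n k : ℕ} (h : n < k) :
    coeff n (L ^ k) = 0 :=
  X_pow_dvd_iff.1 (pow_dvd_pow_of_dvd (X_dvd_iff.2 hL) k) n h

theorem eq_zero_of_derivative_eq_mul {H L : PowerSeries K} (h : derivative K H = L * H)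
    (h0 : coeff 0 H = 0) : H = 0 := by
  ext n
  induction n using Nat.strong_induction_on with
  | _ n ih =>
    cases n with
    | zero => simpa using h0
    | succ n =>
      have h1 := congrArg (coeff n) h
      rw [coeff_derivative, coeff_mul, Finset.sum_eq_zero] at h1
      · have : (n : K) + 1 ≠ 0 := Nat.cast_add_one_ne_zero n
        simpa [this] using h1
      · intro x hx
        rw [ih x.2 (by have := Finset.HasAntidiagonal.mem_antidiagonal.1 hx; omega), map_zero,
          mul_zero]

/-- The exponential of a power series with zero constant term. -/
def expOf (L : PowerSeries K) : PowerSeries K :=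
  mk fun n => ∑ k ∈ Finset.range (n + 1), (k.factorial : K)⁻¹ * coeff n (L ^ k)

theorem coeff_expOf {L : PowerSeries K} (hL : constantCoeff L = 0) {n N : ℕ} (h : n < N) :
    coeff n (expOf L) = ∑ k ∈ Finset.range N, (k.factorial : K)⁻¹ * coeff n (L ^ k) := by
  rw [expOf, coeff_mk]
  refine Finset.sum_subset (Finset.range_mono h) fun k _ hk => ?_
  rw [coeff_pow_eq_zero hL (by simpa using hk), mul_zero]

theorem derivative_expOf {L : PowerSeries K} (hL : constantCoeff L = 0) :
    derivative K (expOf L) = derivative K L * expOf L := by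
  ext n
  trans ∑ k ∈ Finset.range (n + 1), (k.factorial : K)⁻¹ * coeff n (derivative K L * L ^ k)
  · rw [coeff_derivative, coeff_expOf hL (Nat.lt_succ_self _), Finset.sum_range_succ', add_mul,
      Finset.sum_mul]
    simp only [pow_zero, coeff_one, Nat.succ_ne_zero, if_false, mul_zero, zero_mul, add_zero]
    refine Finset.sum_congr rfl fun k _ => ?_
    rw [mul_assoc, ← Nat.cast_succ, ← Nat.succ_eq_add_one, Nat.cast_succ, ← coeff_derivative,
      Derivation.leibniz_pow, Nat.succ_sub_one, smul_eq_mul, map_nsmul, nsmul_eq_mul,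
      Nat.succ_eq_add_one, Nat.factorial_succ, mul_comm (L ^ k)]
    have : ((k + 1 : ℕ) : K) ≠ 0 := Nat.cast_ne_zero.2 k.succ_ne_zero
    push_cast at this ⊢
    have h2 : (k.factorial : K) ≠ 0 := Nat.cast_ne_zero.2 k.factorial_ne_zero
    field_simp
  · simp only [coeff_mul, Finset.mul_sum]
    rw [Finset.sum_comm]
    refine Finset.sum_congr rfl fun x hx => ?_
    have := Finset.HasAntidiagonal.mem_antidiagonal.1 hx
    rw [coeff_expOf hL (show x.2 < n + 1 by omega), Finset.mul_sum]
    exact Finset.sum_congr rfl fun _ _ => by ring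

theorem expOf_logDilog {w : K} (hw0 : w ≠ 0) (hw : ∀ j, w ^ (2 * (j + 1)) ≠ 1) :
    expOf (logDilog w) = dilog w := by
  refine sub_eq_zero.1 (eq_zero_of_derivative_eq_mul (L := derivative K (logDilog w)) ?_ ?_)
  · rw [map_sub, derivative_expOf (constantCoeff_logDilog w), derivative_dilog hw0 hw, mul_sub]
  · simp [expOf, constantCoeff_dilog]

end PowerSeries

namespace QPlane

variable {γ : ℕ}

open Finset in
theorem coeff_pow_eq_zero {Z : QPlane γ} (hZ : Z.coeff 0 0 = 0) {k m n : ℕ} (h : m + n < k) :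
    (Z ^ k).coeff m n = 0 := by
  induction k generalizing m n with
  | zero => omega
  | succ k ih =>
    rw [pow_succ', coeff_mul]
    refine sum_eq_zero fun x hx => sum_eq_zero fun y hy => ?_
    have hx := HasAntidiagonal.mem_antidiagonal.1 hx
    have hy := HasAntidiagonal.mem_antidiagonal.1 hy
    by_cases hxy : x.1 = 0 ∧ y.1 = 0
    · rw [hxy.1, hxy.2, hZ, mul_zero, zero_mul]
    · rw [ih (by omega), mul_zero]

/-- The substitution of `Z` into a power series `f`. -/
def eval (Z : QPlane γ) (f : PowerSeries K) : QPlane γ := fun p =>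
  ∑ k ∈ Finset.range (p.1 + p.2 + 1), PowerSeries.coeff k f * (Z ^ k).coeff p.1 p.2

theorem coeff_eval {Z : QPlane γ} (hZ : Z.coeff 0 0 = 0) (f : PowerSeries K) {m n N : ℕ}
    (h : m + n < N) :
    (eval Z f).coeff m n = ∑ k ∈ Finset.range N, PowerSeries.coeff k f * (Z ^ k).coeff m n := by
  refine Finset.sum_subset (Finset.range_mono h) fun k _ hk => ?_
  rw [coeff_pow_eq_zero hZ (by simpa using hk), mul_zero]

open Finset in
theorem coeff_eval_mul {Z : QPlane γ} (hZ : Z.coeff 0 0 = 0) (f : PowerSeries K) (T : QPlane γ)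
    {m n N : ℕ} (h : m + n < N) :
    (eval Z f * T).coeff m n =
      ∑ k ∈ range N, PowerSeries.coeff k f * (Z ^ k * T).coeff m n := by
  simp only [coeff_mul, mul_sum]
  rw [sum_comm (s := range N)]
  refine sum_congr rfl fun x hx => ?_
  rw [sum_comm (s := range N)]
  refine sum_congr rfl fun y hy => ?_
  have hx := HasAntidiagonal.mem_antidiagonal.1 hx
  have hy := HasAntidiagonal.mem_antidiagonal.1 hy
  rw [coeff_eval hZ f (show x.1 + y.1 < N by omega), mul_sum, sum_mul]
  exact sum_congr rfl fun _ _ => by ring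

open Finset in
theorem coeff_mul_eval {Z : QPlane γ} (hZ : Z.coeff 0 0 = 0) (f : PowerSeries K) (T : QPlane γ)
    {m n N : ℕ} (h : m + n < N) :
    (T * eval Z f).coeff m n =
      ∑ k ∈ range N, PowerSeries.coeff k f * (T * Z ^ k).coeff m n := by
  simp only [coeff_mul, mul_sum]
  rw [sum_comm (s := range N)]
  refine sum_congr rfl fun x hx => ?_
  rw [sum_comm (s := range N)]
  refine sum_congr rfl fun y hy => ?_
  have hx := HasAntidiagonal.mem_antidiagonal.1 hx
  have hy := HasAntidiagonal.mem_antidiagonal.1 hy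
  rw [coeff_eval hZ f (show x.2 + y.2 < N by omega), mul_sum]
  exact sum_congr rfl fun _ _ => by ring

open Finset in
theorem eval_mul {Z : QPlane γ} (hZ : Z.coeff 0 0 = 0) (f g : PowerSeries K) :
    eval Z (f * g) = eval Z f * eval Z g := by
  ext m n
  rw [coeff_eval_mul hZ f _ (Nat.lt_succ_self (m + n)), coeff_eval hZ _ (Nat.lt_succ_self (m + n))]
  trans ∑ j ∈ range (m + n + 1), ∑ k ∈ range (j + 1),
    PowerSeries.coeff k f * (PowerSeries.coeff (j - k) g * (Z ^ (k + (j - k))).coeff m n)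
  · refine sum_congr rfl fun j _ => ?_
    rw [PowerSeries.coeff_mul, Nat.sum_antidiagonal_eq_sum_range_succ_mk, sum_mul]
    refine sum_congr rfl fun k hk => ?_
    rw [Nat.add_sub_cancel' (Nat.lt_succ_iff.1 (mem_range.1 hk))]
    ring
  · rw [sum_range_diag_flip (m + n + 1) fun k l =>
      PowerSeries.coeff k f * (PowerSeries.coeff l g * (Z ^ (k + l)).coeff m n)]
    refine sum_congr rfl fun k hk => ?_
    rw [coeff_mul_eval hZ g _ (Nat.lt_succ_self (m + n)), mul_sum]
    simp only [← pow_add]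
    refine sum_subset (range_mono (Nat.sub_le _ _)) fun l _ hl => ?_
    rw [coeff_pow_eq_zero hZ (k := k + l) (by have := mem_range.not.1 hl; omega), mul_zero,
      mul_zero]

theorem eval_X {Z : QPlane γ} (hZ : Z.coeff 0 0 = 0) : eval Z PowerSeries.X = Z := by
  ext m n
  rw [coeff_eval hZ _ (show m + n < m + n + 2 by omega), Finset.sum_eq_single 1]
  · simp
  · intro k _ hk
    simp [PowerSeries.coeff_X, hk]
  · simp

theorem eval_one {Z : QPlane γ} (hZ : Z.coeff 0 0 = 0) : eval Z 1 = 1 := by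
  ext m n
  rw [coeff_eval hZ _ (Nat.lt_succ_self (m + n)), Finset.sum_eq_single 0]
  · simp
  · intro k _ hk
    simp [PowerSeries.coeff_one, hk]
  · simp

/-- Substitution of an element with zero constant term, as an algebra homomorphism. -/
def evalHom (Z : QPlane γ) (hZ : Z.coeff 0 0 = 0) : PowerSeries K →ₐ[K] QPlane γ :=
  AlgHom.ofLinearMap
    { toFun := eval Z
      map_add' := fun f g => by
        ext m n
        simp [coeff_eval hZ _ (Nat.lt_succ_self (m + n)), add_mul, Finset.sum_add_distrib]
      map_smul' := fun c f => by
        ext m n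
        simp [coeff_eval hZ _ (Nat.lt_succ_self (m + n)), mul_assoc, Finset.mul_sum] }
    (eval_one hZ) (eval_mul hZ)

theorem evalHom_apply {Z : QPlane γ} (hZ : Z.coeff 0 0 = 0) (f : PowerSeries K) :
    evalHom Z hZ f = eval Z f := rfl

theorem eval_one_add_smul_X {Z : QPlane γ} (hZ : Z.coeff 0 0 = 0) (c : K) :
    eval Z (1 + c • PowerSeries.X) = 1 + c • Z := by
  rw [← evalHom_apply hZ, map_add, map_one, map_smul, evalHom_apply, eval_X hZ]

theorem pow_mul_of_qcommute {Z T : QPlane γ} {q : K} (h : Z * T = q • (T * Z)) (k : ℕ) :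
    Z ^ k * T = q ^ k • (T * Z ^ k) := by
  induction k with
  | zero => simp
  | succ k ih =>
    rw [pow_succ, mul_assoc, h, mul_smul_comm, ← mul_assoc, ih, smul_mul_assoc, smul_smul,
      mul_assoc, pow_succ' q]

theorem eval_mul_of_qcommute {Z T : QPlane γ} (hZ : Z.coeff 0 0 = 0) {q : K}
    (h : Z * T = q • (T * Z)) (f : PowerSeries K) :
    eval Z f * T = T * eval Z (PowerSeries.rescale q f) := by
  ext m n
  rw [coeff_eval_mul hZ f _ (Nat.lt_succ_self (m + n)),
    coeff_mul_eval hZ _ _ (Nat.lt_succ_self (m + n))]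
  refine Finset.sum_congr rfl fun k _ => ?_
  rw [pow_mul_of_qcommute h, coeff_smul, PowerSeries.coeff_rescale]
  ring

/-- The automorphism `Y₁ ↦ t Y₁`, `Y₂ ↦ Y₂`. -/
def scale (t : K) : QPlane γ →+* QPlane γ where
  toFun F := fun p => t ^ p.1 * F p
  map_zero' := by
    ext m n
    exact mul_zero _
  map_add' F G := by
    ext m n
    exact mul_add _ _ _
  map_one' := by
    ext m n
    change t ^ m * (1 : QPlane γ).coeff m n = _
    rw [coeff_one]
    split_ifs with h
    · simp [h.1]
    · simp
  map_mul' F G := by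
    ext m n
    have key : ∀ F' G' : QPlane γ, (∀ a b, F'.coeff a b = t ^ a * F.coeff a b) →
        (∀ a b, G'.coeff a b = t ^ a * G.coeff a b) →
        t ^ m * (F * G).coeff m n = (F' * G').coeff m n := by
      intro F' G' hF hG
      simp only [coeff_mul, Finset.mul_sum, hF, hG]
      refine Finset.sum_congr rfl fun x hx => Finset.sum_congr rfl fun y _ => ?_
      rw [← Finset.HasAntidiagonal.mem_antidiagonal.1 hx]
      ring
    exact key _ _ (fun _ _ => rfl) (fun _ _ => rfl)

theorem coeff_scale (t : K) (F : QPlane γ) (m n : ℕ) :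
    (scale t F).coeff m n = t ^ m * F.coeff m n := rfl

theorem scale_eval {Z : QPlane γ} (hZ : Z.coeff 0 0 = 0) {t q : K} (h : scale t Z = q • Z)
    (f : PowerSeries K) : scale t (eval Z f) = eval Z (PowerSeries.rescale q f) := by
  ext m n
  rw [coeff_scale, coeff_eval hZ _ (Nat.lt_succ_self (m + n)),
    coeff_eval hZ _ (Nat.lt_succ_self (m + n)), Finset.mul_sum]
  refine Finset.sum_congr rfl fun k _ => ?_
  have hk : scale t (Z ^ k) = q ^ k • Z ^ k := by rw [map_pow, h, smul_pow]
  have hk' := congrArg (fun F => F.coeff m n) hk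
  simp only [coeff_scale, coeff_smul] at hk'
  rw [PowerSeries.coeff_rescale]
  linear_combination PowerSeries.coeff k f * hk'

/-- The anti-automorphism exchanging `Y₁` and `Y₂`. -/
def swap (F : QPlane γ) : QPlane γ := fun p => F (p.2, p.1)

theorem coeff_swap (F : QPlane γ) (m n : ℕ) : (swap F).coeff m n = F.coeff n m := rfl

theorem swap_mul (F G : QPlane γ) : swap (F * G) = swap G * swap F := by
  ext m n
  rw [coeff_swap, coeff_mul, coeff_mul, Finset.sum_comm, ← Finset.Nat.sum_antidiagonal_swap]
  refine Finset.sum_congr rfl fun x _ => ?_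
  rw [← Finset.Nat.sum_antidiagonal_swap]
  refine Finset.sum_congr rfl fun y _ => ?_
  simp only [coeff_swap, Prod.fst_swap, Prod.snd_swap]
  ring

theorem swap_pow (F : QPlane γ) (k : ℕ) : swap (F ^ k) = swap F ^ k := by
  induction k with
  | zero =>
    ext m n
    simp [coeff_swap, coeff_one, and_comm]
  | succ k ih => rw [pow_succ, swap_mul, ih, pow_succ']

theorem swap_eval {Z : QPlane γ} (hZ : Z.coeff 0 0 = 0) (f : PowerSeries K) :
    swap (eval Z f) = eval (swap Z) f := by
  ext m n
  rw [coeff_swap, coeff_eval hZ f (show n + m < m + n + 1 by omega),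
    coeff_eval (Z := swap Z) hZ f (Nat.lt_succ_self (m + n))]
  simp only [← swap_pow, coeff_swap]

theorem qarg_eq_eval {Z : QPlane γ} (w : K) :
    qarg γ w Z = eval Z (logDilog w) := by
  funext r
  simp only [qarg, eval, logDilog, PowerSeries.coeff_mk, qpow_eq_pow]
  refine Finset.sum_subset (fun k hk => ?_) fun k hk hk' => ?_
  · rw [Finset.mem_Icc] at hk
    exact Finset.mem_range.2 (by omega)
  · rw [Finset.mem_Icc] at hk'
    rw [Finset.mem_range] at hk
    obtain rfl : k = 0 := by omega
    simp

theorem qPsi_eq_eval {Z : QPlane γ} (hZ : Z.coeff 0 0 = 0) {w : K} (hw0 : w ≠ 0)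
    (hw : ∀ j, w ^ (2 * (j + 1)) ≠ 1) : qPsi γ w Z = eval Z (dilog w) := by
  funext ⟨m, n⟩
  change ∑ k ∈ Finset.range (m + n + 1), ((Nat.factorial k : K)⁻¹) *
    coeff (γ := γ) (qpow γ (qarg γ w Z) k) m n = (eval Z (dilog w)).coeff m n
  rw [coeff_eval hZ _ (Nat.lt_succ_self (m + n)), ← PowerSeries.expOf_logDilog hw0 hw]
  trans ∑ k ∈ Finset.range (m + n + 1), ∑ i ∈ Finset.range (m + n + 1), ((Nat.factorial k : K)⁻¹) *
    (PowerSeries.coeff i (logDilog w ^ k) * (Z ^ i).coeff m n)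
  · refine Finset.sum_congr rfl fun k _ => ?_
    rw [qarg_eq_eval w, qpow_eq_pow, ← evalHom_apply hZ, ← map_pow, evalHom_apply,
      coeff_eval hZ _ (Nat.lt_succ_self (m + n)), Finset.mul_sum]
  · rw [Finset.sum_comm]
    refine Finset.sum_congr rfl fun i hi => ?_
    rw [PowerSeries.coeff_expOf (PowerSeries.constantCoeff_logDilog w) (Finset.mem_range.1 hi),
      Finset.sum_mul]
    exact Finset.sum_congr rfl fun _ _ => by ring

theorem coeff_zero_mul_eq_zero {H : QPlane γ} (h : ∀ n, H.coeff 0 n = 0) (G : QPlane γ) (n : ℕ) :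
    (H * G).coeff 0 n = 0 := by
  rw [coeff_mul]
  refine Finset.sum_eq_zero fun x hx => Finset.sum_eq_zero fun y _ => ?_
  have hx := Finset.HasAntidiagonal.mem_antidiagonal.1 hx
  rw [show x.1 = 0 by omega, h, mul_zero, zero_mul]

theorem coeff_zero_mul_eq_zero' {H : QPlane γ} (h : ∀ n, H.coeff 0 n = 0) (G : QPlane γ) (n : ℕ) :
    (G * H).coeff 0 n = 0 := by
  rw [coeff_mul]
  refine Finset.sum_eq_zero fun x hx => Finset.sum_eq_zero fun y _ => ?_
  have hx := Finset.HasAntidiagonal.mem_antidiagonal.1 hx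
  rw [show x.2 = 0 by omega, h, mul_zero]

/-- An element is determined by its part free of `Y₁` and its behaviour under `scale`. -/
theorem eq_of_scale_eq {t : K} (ht : ∀ m, t ^ (m + 1) ≠ 1) {X F G : QPlane γ}
    (hX : ∀ n, X.coeff 0 n = 0) (hF : scale t F = F * (1 + X)) (hG : scale t G = G * (1 + X))
    (h0 : ∀ n, F.coeff 0 n = G.coeff 0 n) : F = G := by
  have hH : scale t (F - G) = (F - G) + (F - G) * X := by
    rw [map_sub, hF, hG]
    noncomm_ring
  have hH0 : ∀ n, (F - G).coeff 0 n = 0 := fun n => sub_eq_zero.2 (h0 n)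
  refine sub_eq_zero.1 ?_
  generalize F - G = H at hH hH0
  ext m n
  induction m using Nat.strong_induction_on generalizing n with
  | _ m ih =>
    cases m with
    | zero => exact hH0 n
    | succ m =>
      have h := congrArg (fun F => F.coeff (m + 1) n) hH
      simp only [coeff_scale, coeff_add] at h
      rw [coeff_mul, Finset.sum_eq_zero, add_zero] at h
      · have h2 : (t ^ (m + 1) - 1) * H.coeff (m + 1) n = 0 := by linear_combination h
        exact (mul_eq_zero.1 h2).resolve_left (sub_ne_zero.2 (ht m))
      · refine fun x hx => Finset.sum_eq_zero fun y _ => ?_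
        have hx := Finset.HasAntidiagonal.mem_antidiagonal.1 hx
        rcases Nat.lt_or_ge x.1 (m + 1) with hlt | hge
        · rw [ih _ hlt]
          simp
        · rw [show x.2 = 0 by omega, hX, mul_zero]

end QPlane

theorem v_pow_ne_one {n : ℕ} (hn : n ≠ 0) : v ^ n ≠ 1 := by
  intro h
  rw [v, ← RatFunc.algebraMap_X, ← map_pow, ← map_one (algebraMap (Polynomial ℚ) (RatFunc ℚ))] at h
  have h2 := congrArg Polynomial.natDegree (RatFunc.algebraMap_injective ℚ h)
  simp [hn] at h2

theorem v_ne_zero : v ≠ 0 := RatFunc.X_ne_zero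

namespace PowerSeries

theorem rescale_pow_four_dilog {w : K} (hw : ∀ j, w ^ (2 * (j + 1)) ≠ 1) :
    rescale (w ^ 4) (dilog w) = (1 + w • X) * ((1 + w ^ 3 • X) * dilog w) := by
  have h : rescale (w ^ 2) (1 + w • (X : PowerSeries K)) = 1 + w ^ 3 • X := by
    ext n
    simp only [map_add, coeff_rescale, map_smul, smul_eq_mul, map_one, coeff_X]
    split_ifs with hn
    · subst hn
      ring
    · ring
  rw [show w ^ 4 = w ^ 2 * w ^ 2 by ring, ← rescale_rescale, rescale_sq_dilog hw, map_mul, h,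
    rescale_sq_dilog hw]
  ring

end PowerSeries

section Conjugation

variable {k R : Type*} [CommRing k] [Ring R] [Algebra k R] {w : k} {X A B Y PA PB PY : R}

theorem conj_by_dilog_Y (hA : A = w ^ 2 • (X * Y)) (hB : B = w ^ 2 • (A * Y))
    (h : PY * X = X * ((1 + w • Y) * ((1 + w ^ 3 • Y) * PY))) :
    PY * (1 + w ^ 2 • X) = (1 + w ^ 2 • X + (w + w ^ 3) • A + w ^ 2 • B) * PY := by
  rw [hB, hA]
  simp only [mul_add, add_mul, mul_smul_comm, smul_mul_assoc, mul_one, one_mul, h, mul_assoc,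
    smul_add, smul_smul]
  module

theorem conj_by_dilog_B (hAA : A * A = w ^ 4 • (X * B))
    (hX : PB * X = X * ((1 + w ^ 2 • B) * ((1 + w ^ 6 • B) * PB)))
    (hA : PB * A = A * ((1 + w ^ 2 • B) * PB)) (hB : PB * B = B * PB) :
    PB * (1 + w ^ 2 • X + (w + w ^ 3) • A + w ^ 2 • B) =
      (1 + (w + w ^ 3) • A + w ^ 4 • (A * A) + w ^ 2 • X) * ((1 + w ^ 2 • B) * PB) := by
  rw [hAA]
  simp only [mul_add, add_mul, mul_smul_comm, smul_mul_assoc, mul_one, one_mul, hX, hA, hB,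
    mul_assoc, smul_add, smul_smul]
  module

theorem conj_by_dilog_A (hX : PA * X = X * ((1 + w • A) * ((1 + w ^ 3 • A) * PA)))
    (hA : PA * A = A * PA) :
    PA * (1 + (w + w ^ 3) • A + w ^ 4 • (A * A) + w ^ 2 • X) =
      (1 + w ^ 2 • X) * ((1 + w • A) * ((1 + w ^ 3 • A) * PA)) := by
  have hAA : PA * (A * A) = A * (A * PA) := by rw [← mul_assoc, hA, mul_assoc, hA]
  simp only [mul_add, add_mul, mul_smul_comm, smul_mul_assoc, mul_one, one_mul, hX, hAA, hA,
    mul_assoc, smul_add, smul_smul]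
  module

end Conjugation

namespace QPlane

variable {γ : ℕ}

/-- The element `v^β · y^{(m,n)}`. -/
def mono (γ : ℕ) (β : ℤ) (m n : ℕ) : QPlane γ := qy γ β m n

theorem coeff_mono (β : ℤ) (m n a b : ℕ) :
    (mono γ β m n).coeff a b =
      if a = m ∧ b = n then v ^ (β + (γ : ℤ) * (m : ℤ) * (n : ℤ)) else 0 := by
  simp [mono, coeff, qy]

theorem mono_mul_mono (β β' : ℤ) (m n m' n' : ℕ) :
    mono γ β m n * mono γ β' m' n' =
      v ^ ((γ : ℤ) * (n * m' - m * n')) • mono γ (β + β') (m + m') (n + n') := by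
  ext a b
  rw [coeff_mul, coeff_smul, coeff_mono]
  split_ifs with h
  · rw [Finset.sum_eq_single (m, m'), Finset.sum_eq_single (n, n')]
    · simp only [coeff_mono, and_self, if_true]
      rw [← zpow_natCast, ← zpow_add₀ v_ne_zero, ← zpow_add₀ v_ne_zero, ← zpow_add₀ v_ne_zero]
      congr 1
      push_cast
      ring
    · rintro ⟨c, d⟩ - hne
      simp only [coeff_mono]
      split_ifs <;> simp_all
    · intro hn
      exact absurd (Finset.HasAntidiagonal.mem_antidiagonal.2 h.2.symm) hn
    · rintro ⟨c, d⟩ - hne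
      refine Finset.sum_eq_zero fun y _ => ?_
      simp only [coeff_mono]
      split_ifs <;> simp_all
    · intro hn
      exact absurd (Finset.HasAntidiagonal.mem_antidiagonal.2 h.1.symm) hn
  · rw [mul_zero]
    refine Finset.sum_eq_zero fun x hx => Finset.sum_eq_zero fun y hy => ?_
    have hx := Finset.HasAntidiagonal.mem_antidiagonal.1 hx
    have hy := Finset.HasAntidiagonal.mem_antidiagonal.1 hy
    simp only [coeff_mono]
    split_ifs with h1 h2
    · exact absurd ⟨by omega, by omega⟩ h
    all_goals simp

theorem scale_mono (t : K) (β : ℤ) (m n : ℕ) : scale t (mono γ β m n) = t ^ m • mono γ β m n := by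
  ext a b
  rw [coeff_scale, coeff_smul, coeff_mono]
  split_ifs with h
  · rw [h.1]
  · simp

theorem swap_mono (β : ℤ) (m n : ℕ) : swap (mono γ β m n) = mono γ β n m := by
  ext a b
  rw [coeff_swap, coeff_mono, coeff_mono]
  simp only [and_comm]
  congr 2
  ring

theorem coeff_zero_eval {Z : QPlane γ} (hZ : ∀ n, Z.coeff 0 n = 0) (f : PowerSeries K) (n : ℕ) :
    (eval Z f).coeff 0 n = PowerSeries.coeff 0 f * (1 : QPlane γ).coeff 0 n := by
  rw [coeff_eval (hZ 0) f (Nat.lt_succ_self (0 + n)), Finset.sum_range_succ', Finset.sum_eq_zero,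
    zero_add, pow_zero]
  intro k _
  rw [pow_succ', coeff_zero_mul_eq_zero hZ, mul_zero]

theorem coeff_zero_dilog_mul {Z : QPlane γ} (hZ : ∀ n, Z.coeff 0 n = 0) (w : K) (G : QPlane γ)
    (n : ℕ) : (eval Z (dilog w) * G).coeff 0 n = G.coeff 0 n := by
  have h : ∀ n, (eval Z (dilog w) - 1).coeff 0 n = 0 := fun n => by
    rw [coeff_sub, coeff_zero_eval hZ]
    simp [PowerSeries.constantCoeff_dilog]
  have h2 := coeff_zero_mul_eq_zero h G n
  rwa [sub_mul, one_mul, coeff_sub, sub_eq_zero] at h2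

theorem coeff_zero_mul_dilog {Z : QPlane γ} (hZ : ∀ n, Z.coeff 0 n = 0) (w : K) (G : QPlane γ)
    (n : ℕ) : (G * eval Z (dilog w)).coeff 0 n = G.coeff 0 n := by
  have h : ∀ n, (eval Z (dilog w) - 1).coeff 0 n = 0 := fun n => by
    rw [coeff_sub, coeff_zero_eval hZ]
    simp [PowerSeries.constantCoeff_dilog]
  have h2 := coeff_zero_mul_eq_zero' h G n
  rwa [mul_sub, mul_one, coeff_sub, sub_eq_zero] at h2

theorem eval_mul_self {Z : QPlane γ} (hZ : Z.coeff 0 0 = 0) (f : PowerSeries K) :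
    eval Z f * Z = Z * eval Z f := by
  have h := eval_mul_of_qcommute hZ (T := Z) (q := 1) (by simp) f
  rwa [PowerSeries.rescale_one, RingHom.id_apply] at h

/-- The factorization of `Ψ_w(Y) Ψ_{w²}(X)` for `X`, `Y` satisfying `Y X = w⁴ X Y`. -/
theorem dilog_mul_dilog {w : K} (hw : ∀ j, w ^ (j + 1) ≠ 1) {X A B Y : QPlane γ}
    (hYX : Y * X = w ^ 4 • (X * Y)) (hAX : A * X = w ^ 4 • (X * A))
    (hBX : B * X = w ^ 8 • (X * B)) (hBA : B * A = w ^ 4 • (A * B))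
    (hAA : A * A = w ^ 4 • (X * B)) (hA : A = w ^ 2 • (X * Y)) (hB : B = w ^ 2 • (A * Y))
    (hX0 : ∀ n, X.coeff 0 n = 0) (hA0 : ∀ n, A.coeff 0 n = 0) (hB0 : ∀ n, B.coeff 0 n = 0)
    (hY0 : Y.coeff 0 0 = 0) (hXs : scale (w ^ 4) X = w ^ 4 • X)
    (hAs : scale (w ^ 4) A = w ^ 4 • A) (hBs : scale (w ^ 4) B = w ^ 4 • B)
    (hYs : scale (w ^ 4) Y = Y) :
    eval Y (dilog w) * eval X (dilog (w ^ 2)) =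
      eval X (dilog (w ^ 2)) * (eval A (dilog w) * (eval B (dilog (w ^ 2)) * eval Y (dilog w))) := by
  have hw1 : ∀ j, w ^ (2 * (j + 1)) ≠ 1 := fun j => hw (2 * j + 1)
  have hw2 : ∀ j, (w ^ 2) ^ (2 * (j + 1)) ≠ 1 := fun j => by
    rw [← pow_mul]
    exact hw (2 * (2 * j + 1) + 1)
  have r1 := PowerSeries.rescale_pow_four_dilog hw1
  have r2 := PowerSeries.rescale_sq_dilog hw2
  have r3 := PowerSeries.rescale_pow_four_dilog hw2
  rw [← pow_mul] at r2 r3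
  rw [← pow_mul] at r3
  norm_num only at r2 r3
  have hYX' := eval_mul_of_qcommute hY0 hYX (dilog w)
  have hAX' := eval_mul_of_qcommute (hA0 0) hAX (dilog w)
  have hBX' := eval_mul_of_qcommute (hB0 0) hBX (dilog (w ^ 2))
  have hBA' := eval_mul_of_qcommute (hB0 0) hBA (dilog (w ^ 2))
  have hXX' := eval_mul_self (hX0 0) (dilog (w ^ 2))
  have hAA' := eval_mul_self (hA0 0) (dilog w)
  have hBB' := eval_mul_self (hB0 0) (dilog (w ^ 2))
  have sX := scale_eval (hX0 0) hXs (dilog (w ^ 2))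
  have sA := scale_eval (hA0 0) hAs (dilog w)
  have sB := scale_eval (hB0 0) hBs (dilog (w ^ 2))
  have sY := scale_eval hY0 (q := 1) (by rw [hYs, one_smul]) (dilog w)
  rw [PowerSeries.rescale_one, RingHom.id_apply] at sY
  simp only [r1, r2, r3, eval_mul hY0, eval_mul (hX0 0), eval_mul (hA0 0), eval_mul (hB0 0),
    eval_one_add_smul_X hY0, eval_one_add_smul_X (hX0 0), eval_one_add_smul_X (hA0 0),
    eval_one_add_smul_X (hB0 0)] at hYX' hAX' hBX' hBA' sX sA sB
  have z0 : ∀ n, (eval Y (dilog w) * eval X (dilog (w ^ 2))).coeff 0 n =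
      (eval X (dilog (w ^ 2)) * (eval A (dilog w) *
        (eval B (dilog (w ^ 2)) * eval Y (dilog w)))).coeff 0 n := fun n => by
    rw [coeff_zero_mul_dilog hX0, coeff_zero_dilog_mul hX0, coeff_zero_dilog_mul hA0,
      coeff_zero_dilog_mul hB0]
  generalize eval Y (dilog w) = PY at *
  generalize eval X (dilog (w ^ 2)) = PX at *
  generalize eval A (dilog w) = PA at *
  generalize eval B (dilog (w ^ 2)) = PB at *
  have cX : PX * (1 + w ^ 2 • X) = (1 + w ^ 2 • X) * PX := by
    simp only [mul_add, add_mul, mul_smul_comm, smul_mul_assoc, mul_one, one_mul, hXX']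
  have cY := conj_by_dilog_Y hA hB hYX'
  have cB := conj_by_dilog_B hAA hBX' hBA' hBB'
  have cA := conj_by_dilog_A hAX' hAA'
  refine eq_of_scale_eq (t := w ^ 4) (X := w ^ 2 • X) (fun m => ?_) (fun n => ?_) ?_ ?_ z0
  · rw [← pow_mul]
    exact hw (4 * m + 3)
  · rw [coeff_smul, hX0, mul_zero]
  · rw [map_mul, sY, sX, mul_assoc, cX]
  · simp only [map_mul, sX, sA, sB, sY]
    calc _ = PX * (1 + w ^ 2 • X) *
          ((1 + w • A) * ((1 + w ^ 3 • A) * PA) * ((1 + w ^ 2 • B) * PB * PY)) := by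
          rw [cX]
      _ = PX * (PA * (1 + (w + w ^ 3) • A + w ^ 4 • (A * A) + w ^ 2 • X) *
          ((1 + w ^ 2 • B) * PB * PY)) := by
          rw [cA]
          simp only [mul_assoc]
      _ = PX * (PA * (PB * (1 + w ^ 2 • X + (w + w ^ 3) • A + w ^ 2 • B) * PY)) := by
          rw [cB]
          simp only [mul_assoc]
      _ = PX * (PA * (PB * (PY * (1 + w ^ 2 • X)))) := by
          rw [cY]
          simp only [mul_assoc]
      _ = _ := by simp only [mul_assoc]

theorem eval_mono_identity {e : ℕ} (he : 0 < e) (β β' : ℤ) :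
    eval (mono (2 * e) β' 0 1) (dilog (v ^ e)) * eval (mono (2 * e) β 1 0) (dilog (v ^ (2 * e))) =
      eval (mono (2 * e) β 1 0) (dilog (v ^ (2 * e))) *
        (eval (mono (2 * e) (β + β') 1 1) (dilog (v ^ e)) *
          (eval (mono (2 * e) (β + 2 * β') 1 2) (dilog (v ^ (2 * e))) *
            eval (mono (2 * e) β' 0 1) (dilog (v ^ e)))) := by
  have hc : ∀ (k : ℕ) (a b : ℤ), a = e * k + b → v ^ a = (v ^ e) ^ k * v ^ b := by
    rintro k a b rfl
    rw [← pow_mul, ← zpow_natCast, ← zpow_add₀ v_ne_zero]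
    push_cast
    rfl
  rw [show v ^ (2 * e) = (v ^ e) ^ 2 by rw [← pow_mul, mul_comm]]
  apply dilog_mul_dilog (w := v ^ e)
  case hw =>
    intro j
    rw [← pow_mul]
    exact v_pow_ne_one (by positivity)
  case hA =>
    rw [mono_mul_mono, smul_smul, ← hc 2 0 _ (by push_cast; ring), zpow_zero, one_smul]
  case hB =>
    rw [mono_mul_mono, smul_smul, ← hc 2 0 _ (by push_cast; ring), zpow_zero, one_smul]
    congr 1
    ring
  all_goals first
    | (simp only [mono_mul_mono, smul_smul]
       congr 1
       · apply hc
         push_cast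
         ring
       · congr 1
         ring)
    | (intro n
       simp [coeff_mono])
    | (rw [scale_mono]
       simp)
    | simp [coeff_mono]

theorem eval_mono_identity_swap {e : ℕ} (he : 0 < e) (β β' : ℤ) :
    eval (mono (2 * e) β' 0 1) (dilog (v ^ (2 * e))) * eval (mono (2 * e) β 1 0) (dilog (v ^ e)) =
      eval (mono (2 * e) β 1 0) (dilog (v ^ e)) *
        (eval (mono (2 * e) (2 * β + β') 2 1) (dilog (v ^ (2 * e))) *
          (eval (mono (2 * e) (β + β') 1 1) (dilog (v ^ e)) *
            eval (mono (2 * e) β' 0 1) (dilog (v ^ (2 * e))))) := by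
  have h := congrArg swap (eval_mono_identity he β' β)
  simp only [swap_mul] at h
  rw [swap_eval (by simp [coeff_mono]), swap_eval (by simp [coeff_mono]),
    swap_eval (by simp [coeff_mono]), swap_eval (by simp [coeff_mono])] at h
  simp only [swap_mono, mul_assoc] at h
  rwa [add_comm β' β, add_comm β' (2 * β)] at h

theorem qPsi_qy {d : ℕ} (hd : 0 < d) (β : ℤ) {m n : ℕ} (h : m ≠ 0 ∨ n ≠ 0) :
    qPsi γ (v ^ d) (qy γ β m n) = eval (mono γ β m n) (dilog (v ^ d)) := by
  refine qPsi_eq_eval (Z := mono γ β m n) ?_ (pow_ne_zero _ v_ne_zero) fun j => ?_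
  · rw [coeff_mono, if_neg]
    rintro ⟨rfl, rfl⟩
    simp at h
  · rw [← pow_mul]
    exact v_pow_ne_one (by positivity)

end QPlane

/-- Lemma A.1, quantum-plane form: in `A_{2e}`,
(i) `Ψ_{v^e}(v^{β'}Y₂)·Ψ_{v^{2e}}(v^{β}Y₁)
  = Ψ_{v^{2e}}(v^{β}Y₁)·Ψ_{v^e}(v^{β+β'}y^{(1,1)})·Ψ_{v^{2e}}(v^{β+2β'}y^{(1,2)})·Ψ_{v^e}(v^{β'}Y₂)`,
(ii) `Ψ_{v^{2e}}(v^{β'}Y₂)·Ψ_{v^e}(v^{β}Y₁)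
  = Ψ_{v^e}(v^{β}Y₁)·Ψ_{v^{2e}}(v^{2β+β'}y^{(2,1)})·Ψ_{v^e}(v^{β+β'}y^{(1,1)})·Ψ_{v^{2e}}(v^{β'}Y₂)`. -/
theorem lemma_A1 (e : ℕ) (he : 0 < e) (β β' : ℤ) :
    (qmul (2 * e) (qPsi (2 * e) (v ^ e) (qy (2 * e) β' 0 1))
        (qPsi (2 * e) (v ^ (2 * e)) (qy (2 * e) β 1 0))
      = qmul (2 * e) (qPsi (2 * e) (v ^ (2 * e)) (qy (2 * e) β 1 0))
          (qmul (2 * e) (qPsi (2 * e) (v ^ e) (qy (2 * e) (β + β') 1 1))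
            (qmul (2 * e) (qPsi (2 * e) (v ^ (2 * e)) (qy (2 * e) (β + 2 * β') 1 2))
              (qPsi (2 * e) (v ^ e) (qy (2 * e) β' 0 1)))))
    ∧
    (qmul (2 * e) (qPsi (2 * e) (v ^ (2 * e)) (qy (2 * e) β' 0 1))
        (qPsi (2 * e) (v ^ e) (qy (2 * e) β 1 0))
      = qmul (2 * e) (qPsi (2 * e) (v ^ e) (qy (2 * e) β 1 0))
          (qmul (2 * e) (qPsi (2 * e) (v ^ (2 * e)) (qy (2 * e) (2 * β + β') 2 1))
            (qmul (2 * e) (qPsi (2 * e) (v ^ e) (qy (2 * e) (β + β') 1 1))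
              (qPsi (2 * e) (v ^ (2 * e)) (qy (2 * e) β' 0 1))))) := by
  have he2 : 0 < 2 * e := by omega
  constructor
  · rw [QPlane.qPsi_qy he _ (by simp), QPlane.qPsi_qy he2 _ (by simp),
      QPlane.qPsi_qy he _ (by simp), QPlane.qPsi_qy he2 _ (by simp)]
    exact QPlane.eval_mono_identity he β β'
  · rw [QPlane.qPsi_qy he2 _ (by simp), QPlane.qPsi_qy he _ (by simp),
      QPlane.qPsi_qy he2 _ (by simp), QPlane.qPsi_qy he _ (by simp)]
    exact QPlane.eval_mono_identity_swap he β β'
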